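/- Let d be a positive natural number, let Σ be a positive definite d×d real matrix with positive definite square root Σ^{1/2}, and let μ ∈ ℝ^d. Define N(μ, Σ) as the pushforward of the d-fold product γ_d of the standard real Gaussian measure under z ↦ μ + Σ^{1/2} z. Then the squared Mahalanobis distance of a point drawn from N(μ, Σ) follows the chi-squared distribution with d degrees of freedom: the pushforward of N(μ, Σ) under x ↦ (x − μ)ᵀ Σ⁻¹ (x − μ) equals the measure on ℝ given by Lebesgue measure weighted by the Gamma probability density with shape d/2 and rate 1/2. -/

import Mathlib

open Matrix MeasureTheory ProbabilityTheory

/-- A positive real factor can be taken out of a complex power. -/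
lemma ofReal_mul_cpow_of_pos {r : ℝ} (hr : 0 < r) {z : ℂ} (hz : z ≠ 0) (s : ℂ) :
    ((r : ℂ) * z) ^ s = (r : ℂ) ^ s * z ^ s := by
  have hr' : (r : ℂ) ≠ 0 := Complex.ofReal_ne_zero.mpr hr.ne'
  rw [Complex.cpow_def_of_ne_zero (mul_ne_zero hr' hz), Complex.cpow_def_of_ne_zero hr',
    Complex.cpow_def_of_ne_zero hz, Complex.log_ofReal_mul hr hz, Complex.ofReal_log hr.le,
    add_mul, Complex.exp_add]

/-- The complex moment-generating function of the Gamma distribution with shape `a` and rate `r`,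
at real points below the rate. -/
lemma complexMGF_gammaMeasure_ofReal {a r s : ℝ} (ha : 0 < a) (hr : 0 < r) (hs : s < r) :
    complexMGF id (gammaMeasure a r) s = ((r : ℂ) / (r - s)) ^ (a : ℂ) := by
  have hrs : 0 < r - s := sub_pos.mpr hs
  have hrs0 : ((r - s : ℝ) : ℂ) ≠ 0 := Complex.ofReal_ne_zero.mpr hrs.ne'
  have hG : (Real.Gamma a : ℂ) ≠ 0 := Complex.ofReal_ne_zero.mpr (Real.Gamma_pos_of_pos ha).ne'
  have hpdf : Measurable (gammaPDF a r) := (measurable_gammaPDFReal a r).ennreal_ofReal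
  rw [complexMGF, gammaMeasure,
    integral_withDensity_eq_integral_toReal_smul hpdf
      (Filter.Eventually.of_forall fun _ => ENNReal.ofReal_lt_top)]
  have hsupp : ∀ x ∉ Set.Ici (0 : ℝ),
      (gammaPDF a r x).toReal • Complex.exp (s * (id x : ℝ)) = 0 := fun x hx => by
    rw [gammaPDF_of_neg (not_le.mp hx)]; simp
  rw [← setIntegral_eq_integral_of_forall_compl_eq_zero hsupp, integral_Ici_eq_integral_Ioi]
  have hcongr : ∀ x ∈ Set.Ioi (0 : ℝ),
      (gammaPDF a r x).toReal • Complex.exp (s * (id x : ℝ)) =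
        ((r : ℂ) ^ (a : ℂ) / Real.Gamma a) *
          ((x : ℂ) ^ ((a : ℂ) - 1) * Complex.exp (-((r - s : ℝ) * x))) := fun x hx => by
    have hx0 : (0 : ℝ) ≤ x := le_of_lt hx
    rw [gammaPDF, ENNReal.toReal_ofReal (gammaPDFReal_nonneg ha hr x), gammaPDFReal, if_pos hx0,
      Complex.real_smul, show -(((r - s : ℝ) : ℂ) * x) = -(r * x) + s * x by push_cast; ring,
      Complex.exp_add]
    push_cast
    rw [Complex.ofReal_cpow hr.le, Complex.ofReal_cpow hx0]
    push_cast
    simp only [id_eq]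
    ring
  rw [setIntegral_congr_fun measurableSet_Ioi hcongr, integral_const_mul,
    Complex.integral_cpow_mul_exp_neg_mul_Ioi (by simpa using ha) hrs, Complex.Gamma_ofReal,
    ← Complex.ofReal_sub, div_eq_mul_one_div (r : ℂ) ((r - s : ℝ) : ℂ),
    ofReal_mul_cpow_of_pos hr (one_div_ne_zero hrs0)]
  field_simp

/-- Exponential moments of the Gamma distribution of order below the rate are finite. -/
lemma Iio_subset_integrableExpSet_gammaMeasure {a r : ℝ} (ha : 0 < a) (hr : 0 < r) :
    Set.Iio r ⊆ integrableExpSet id (gammaMeasure a r) := fun s hs => by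
  by_contra h
  have h0 : complexMGF id (gammaMeasure a r) s = 0 := by
    rw [complexMGF_ofReal, mgf_undef h, Complex.ofReal_zero]
  rw [complexMGF_gammaMeasure_ofReal ha hr hs, Complex.cpow_eq_zero_iff, ← Complex.ofReal_sub,
    ← Complex.ofReal_div, Complex.ofReal_eq_zero] at h0
  exact (div_pos hr (sub_pos.mpr hs)).ne' h0.1

/-- The complex moment-generating function of the Gamma distribution with shape `a` and rate `r`,
on the half-plane to the left of the rate. -/
lemma complexMGF_gammaMeasure {a r : ℝ} (ha : 0 < a) (hr : 0 < r) {z : ℂ} (hz : z.re < r) :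
    complexMGF id (gammaMeasure a r) z = ((r : ℂ) / (r - z)) ^ (a : ℂ) := by
  have hopen : IsOpen {z : ℂ | z.re < r} := isOpen_lt Complex.continuous_re continuous_const
  have hL : AnalyticOnNhd ℂ (complexMGF id (gammaMeasure a r)) {z | z.re < r} :=
    analyticOnNhd_complexMGF.mono fun w hw =>
      interior_maximal (Iio_subset_integrableExpSet_gammaMeasure ha hr) isOpen_Iio hw
  have hR : AnalyticOnNhd ℂ (fun z : ℂ => ((r : ℂ) / (r - z)) ^ (a : ℂ)) {z | z.re < r} := by
    refine DifferentiableOn.analyticOnNhd (fun w hw => ?_) hopen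
    have hre : 0 < ((r : ℂ) - w).re := by simpa using hw
    have h0 : (r : ℂ) - w ≠ 0 := fun h => by simp [h] at hre
    have hslit : (r : ℂ) / (r - w) ∈ Complex.slitPlane := by
      refine Or.inl ?_
      rw [div_eq_mul_inv, Complex.re_ofReal_mul, Complex.inv_re]
      exact mul_pos hr (div_pos hre (Complex.normSq_pos.mpr h0))
    exact (DifferentiableAt.cpow ((differentiableAt_const _).div
      ((differentiableAt_const _).sub differentiableAt_id) h0)
      (differentiableAt_const _) hslit).differentiableWithinAt
  refine hL.eqOn_of_preconnected_of_frequently_eq hR (convex_halfSpace_re_lt r).isPreconnected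
    (z₀ := ((0 : ℝ) : ℂ)) (by simpa using hr) ?_ hz
  have htendsto : Filter.Tendsto (fun x : ℝ => (x : ℂ)) (nhdsWithin 0 {0}ᶜ)
      (nhdsWithin ((0 : ℝ) : ℂ) {((0 : ℝ) : ℂ)}ᶜ) :=
    Complex.continuous_ofReal.continuousAt.continuousWithinAt.tendsto_nhdsWithin
      fun x hx => by simpa using hx
  refine htendsto.frequently (Filter.Eventually.frequently ?_)
  filter_upwards [mem_nhdsWithin_of_mem_nhds (Iio_mem_nhds hr)] with x hx
  exact complexMGF_gammaMeasure_ofReal ha hr hx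

/-- The characteristic function of the Gamma distribution with shape `a` and rate `r`. -/
lemma charFun_gammaMeasure {a r : ℝ} (ha : 0 < a) (hr : 0 < r) (t : ℝ) :
    charFun (gammaMeasure a r) t = ((r : ℂ) / (r - t * Complex.I)) ^ (a : ℂ) := by
  rw [← complexMGF_id_mul_I, complexMGF_gammaMeasure ha hr (by simpa using hr)]

/-- The characteristic function of the square of a standard Gaussian variable. -/
lemma charFun_map_sq_gaussianReal (t : ℝ) :
    charFun ((gaussianReal 0 1).map fun x => x ^ 2) t =
      (((1 / 2 : ℝ) : ℂ) / ((1 / 2 : ℝ) - t * Complex.I)) ^ (1 / 2 : ℂ) := by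
  set b : ℂ := ((1 / 2 : ℝ) : ℂ) - t * Complex.I with hb
  have hbre : 0 < b.re := by simp [hb]
  have hb0 : b ≠ 0 := fun h => by simp [h] at hbre
  have hsqrt : ((2 * Real.pi : ℝ) : ℂ) ^ (1 / 2 : ℂ) = (√(2 * Real.pi) : ℝ) := by
    rw [Real.sqrt_eq_rpow, Complex.ofReal_cpow (by positivity)]
    norm_num
  have hsqrt0 : ((√(2 * Real.pi) : ℝ) : ℂ) ≠ 0 := Complex.ofReal_ne_zero.mpr (by positivity)
  rw [charFun_apply_real, integral_map (by fun_prop) (by fun_prop),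
    integral_gaussianReal_eq_integral_smul one_ne_zero]
  have hcongr : ∀ x : ℝ,
      gaussianPDFReal 0 1 x • Complex.exp (t * (x ^ 2 : ℝ) * Complex.I) =
        ((√(2 * Real.pi) : ℝ) : ℂ)⁻¹ * Complex.exp (-b * (x : ℂ) ^ 2) := fun x => by
    rw [gaussianPDFReal, Complex.real_smul,
      show -b * (x : ℂ) ^ 2 = -(x : ℂ) ^ 2 / 2 + t * (x : ℂ) ^ 2 * Complex.I by
        rw [hb]; push_cast; ring, Complex.exp_add]
    simp [mul_assoc]
  simp_rw [hcongr]
  rw [integral_const_mul, integral_gaussian_complex hbre,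
    show (Real.pi : ℂ) / b = ((2 * Real.pi : ℝ) : ℂ) * (((1 / 2 : ℝ) : ℂ) / b) by
      push_cast; field_simp,
    ofReal_mul_cpow_of_pos (by positivity) (div_ne_zero (by norm_num) hb0), hsqrt,
    inv_mul_cancel_left₀ hsqrt0]

/-- The sum of the squares of `d` independent standard Gaussian variables has the Gamma
distribution with shape `d / 2` and rate `1 / 2`. -/
lemma map_sum_sq_pi_gaussianReal {d : ℕ} (hd : 0 < d) :
    (Measure.pi fun _ : Fin d => gaussianReal 0 1).map (fun z => ∑ i, z i ^ 2) =
      gammaMeasure ((d : ℝ) / 2) (1 / 2) := by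
  have ha : (0 : ℝ) < (d : ℝ) / 2 := by positivity
  have : IsProbabilityMeasure (gammaMeasure ((d : ℝ) / 2) (1 / 2)) :=
    isProbabilityMeasure_gammaMeasure ha (by norm_num)
  have hprob : IsProbabilityMeasure ((gaussianReal 0 1).map fun x => x ^ 2) :=
    Measure.isProbabilityMeasure_map (by fun_prop)
  have hmap : (Measure.pi fun _ : Fin d => gaussianReal 0 1).map (fun z => ∑ i, z i ^ 2) =
      (Measure.pi fun _ : Fin d => (gaussianReal 0 1).map fun x => x ^ 2).map
        (fun p => ∑ i, p i) := by
    rw [← Measure.pi_map_pi (fun _ => by fun_prop), Measure.map_map (by fun_prop) (by fun_prop)]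
    rfl
  rw [hmap]
  refine Measure.ext_of_charFun (funext fun t => ?_)
  rw [charFun_map_sum_pi_eq_prod, Finset.prod_apply, charFun_gammaMeasure ha (by norm_num)]
  simp_rw [charFun_map_sq_gaussianReal]
  rw [Finset.prod_const, Finset.card_univ, Fintype.card_fin, ← Complex.cpow_nat_mul]
  congr 1
  push_cast
  ring

/-- Property 2: the squared Mahalanobis distance of a point drawn from the multivariate
normal `N(μ, Σ)` follows the chi-squared distribution with `d` degrees of freedom, i.e. the
Gamma distribution with shape `d/2` and rate `1/2`. -/
theorem sq_mahalanobis_multivariate_normal_chiSq (d : ℕ) (hd : 0 < d)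
    (S Shalf : Matrix (Fin d) (Fin d) ℝ)
    (hS : S.PosDef) (hShalf : Shalf.PosDef) (hsq : Shalf * Shalf = S)
    (μ : Fin d → ℝ) :
    Measure.map (fun x : Fin d → ℝ => (x - μ) ⬝ᵥ (S⁻¹ *ᵥ (x - μ)))
        (Measure.map (fun z : Fin d → ℝ => μ + Shalf *ᵥ z)
          (Measure.pi fun _ : Fin d => gaussianReal 0 1)) =
      volume.withDensity (gammaPDF ((d : ℝ) / 2) (1 / 2)) := by
  have hunit : IsUnit Shalf.det := hShalf.det_pos.ne'.isUnit
  have hsymm : Shalfᵀ = Shalf := by simpa using hShalf.isHermitian.eq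
  have hquad (z : Fin d → ℝ) :
      (Shalf *ᵥ z) ⬝ᵥ (S⁻¹ *ᵥ (Shalf *ᵥ z)) = ∑ i, z i ^ 2 := by
    have hinv : Shalf * (S⁻¹ * Shalf) = 1 := by
      rw [← hsq, Matrix.mul_inv_rev, Matrix.mul_assoc, Matrix.nonsing_inv_mul _ hunit,
        Matrix.mul_one, Matrix.mul_nonsing_inv _ hunit]
    rw [← Matrix.vecMul_transpose Shalf z, hsymm, ← Matrix.dotProduct_mulVec,
      ← hsymm, Matrix.vecMul_transpose, hsymm, Matrix.mulVec_mulVec, Matrix.mulVec_mulVec,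
      Matrix.mul_assoc, hinv, Matrix.one_mulVec]
    simp [dotProduct, sq]
  have hlin (A : Matrix (Fin d) (Fin d) ℝ) : Continuous fun z : Fin d → ℝ => A *ᵥ z :=
    continuous_const.matrix_mulVec continuous_id
  rw [Measure.map_map]
  · simp only [Function.comp_def, add_sub_cancel_left, hquad]
    exact map_sum_sq_pi_gaussianReal hd
  · exact ((continuous_id.sub continuous_const).dotProduct
      ((hlin S⁻¹).comp (continuous_id.sub continuous_const))).measurable
  · exact (continuous_const.add (hlin Shalf)).measurable
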